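/- In ℝ⁸ with the standard inner product, let ε₁,…,ε₈ be the standard basis and ε = ε₇+ε₈. Define the E₇ simple roots α_i = ε_i − ε_{i+1} for i = 1,…,5, α₆ = ε₅+ε₆, α₇ = ½(ε − (ε₁+⋯+ε₆)), and the set of noncompact positive roots Δ⁺_nc = { ε₁ − ε_j, ε₁ + ε_j : 2 ≤ j ≤ 6 } ∪ { ε } ∪ { ½(ε₁ + ε + Σ_{i=2}^6 s_i ε_i) : s_i ∈ {±1}, Π_{i=2}^6 s_i = 1 }. Suppose Λ = Σ_{i=1}^6 Λ_i ε_i + Λ₀ ε (with Λ_i, Λ₀ ∈ ℝ) satisfies: ⟨Λ, α_j⟩ is a nonnegative integer for each j = 1,…,7, and ⟨Λ, α⟩ ∈ {0, 1} for every α ∈ Δ⁺_nc. Then Λ = 0 or Λ = ε₁ + ½ ε. -/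

import Mathlib

open RealInnerProductSpace

noncomputable section

/-- ℝ⁸ with the standard inner product. -/
abbrev E8V : Type := EuclideanSpace ℝ (Fin 8)

/-- The standard basis vectors ε₁,…,ε₈ of ℝ⁸ (0-indexed: `εv i` is ε_{i+1}). -/
def εv (i : Fin 8) : E8V := EuclideanSpace.single i 1

/-- ε = ε₇ + ε₈. -/
def epsE7 : E8V := εv 6 + εv 7

/-- Embedding of the index range {1,…,6} (0-indexed `Fin 6`) into `Fin 8`. -/
def ι6 (i : Fin 6) : Fin 8 := Fin.castLE (by norm_num) i

/-- Embedding of the index range {2,…,6} (parametrized by `Fin 5`) into `Fin 8`. -/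
def ι25 (i : Fin 5) : Fin 8 := Fin.castLE (by norm_num) i.succ

/-- The simple roots α₁,…,α₇ of E₇:
α_i = ε_i − ε_{i+1} for i = 1,…,5, α₆ = ε₅+ε₆, α₇ = ½(ε − (ε₁+⋯+ε₆)). -/
def simpleE7 : Fin 7 → E8V :=
  ![εv 0 - εv 1, εv 1 - εv 2, εv 2 - εv 3, εv 3 - εv 4, εv 4 - εv 5, εv 4 + εv 5,
    (1/2 : ℝ) • (epsE7 - (εv 0 + εv 1 + εv 2 + εv 3 + εv 4 + εv 5))]

/-- The noncompact positive roots of E₇: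
Δ⁺_nc = { ε₁ ± ε_j : 2 ≤ j ≤ 6 } ∪ { ε } ∪
        { ½(ε₁ + ε + Σ_{i=2}^6 s_i ε_i) : s_i = ±1, Π s_i = 1 }. -/
def ncRootsE7 : Set E8V :=
  {v | (∃ j : Fin 5, v = εv 0 - εv (ι25 j) ∨ v = εv 0 + εv (ι25 j)) ∨
       v = epsE7 ∨
       (∃ s : Fin 5 → ℝ, (∀ i, s i = 1 ∨ s i = -1) ∧ (∏ i, s i) = 1 ∧
         v = (1/2 : ℝ) • (εv 0 + epsE7 + ∑ i : Fin 5, s i • εv (ι25 i)))}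

end

open RealInnerProductSpace

lemma inner_εv (x : E8V) (i : Fin 8) : ⟪x, εv i⟫ = x i := by
  simp [εv, EuclideanSpace.inner_single_right]

/-- The expansion of the highest root `ε` of E₇ in the simple roots. -/
lemma epsE7_eq_sum_simpleE7 :
    epsE7 = simpleE7 0 + (2 : ℝ) • simpleE7 1 + (3 : ℝ) • simpleE7 2 + (4 : ℝ) • simpleE7 3 +
      (2 : ℝ) • simpleE7 4 + (3 : ℝ) • simpleE7 5 + (2 : ℝ) • simpleE7 6 := by
  simp [simpleE7]
  module

/-- classification of dominant E₇ weights Λ with ⟨Λ,α⟩ ∈ {0,1} for all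
noncompact positive roots α: Λ = 0 or Λ = ε₁ + ½ε. -/
theorem stmt9 (Λc : Fin 6 → ℝ) (Λ0 : ℝ) (Λ : E8V)
    (hΛ : Λ = ∑ i : Fin 6, Λc i • εv (ι6 i) + Λ0 • epsE7)
    (hdom : ∀ j : Fin 7, ∃ n : ℕ, ⟪Λ, simpleE7 j⟫ = (n : ℝ))
    (hmin : ∀ α ∈ ncRootsE7, ⟪Λ, α⟫ = 0 ∨ ⟪Λ, α⟫ = 1) :
    Λ = 0 ∨ Λ = εv 0 + (1/2 : ℝ) • epsE7 := by
  choose n hn using hdom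
  have heps := hmin epsE7 (Or.inr (Or.inl rfl))
  have hsum : ⟪Λ, epsE7⟫ = ((n 0 + 2 * n 1 + 3 * n 2 + 4 * n 3 + 2 * n 4 + 3 * n 5 + 2 * n 6 : ℕ) :
      ℝ) := by
    rw [epsE7_eq_sum_simpleE7]
    simp only [inner_add_right, inner_smul_right, hn]
    push_cast
    ring
  have hn0 : n 0 = 0 ∨ n 0 = 1 := by
    rw [hsum] at heps
    norm_cast at heps
    omega
  have hzero : n 1 = 0 ∧ n 2 = 0 ∧ n 3 = 0 ∧ n 4 = 0 ∧ n 5 = 0 ∧ n 6 = 0 := by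
    rw [hsum] at heps
    norm_cast at heps
    omega
  obtain ⟨h1, h2, h3, h4, h5, h6⟩ := hzero
  have hcoord (i : Fin 8) : Λ i = ![Λc 0, Λc 1, Λc 2, Λc 3, Λc 4, Λc 5, Λ0, Λ0] i := by
    rw [hΛ]
    fin_cases i <;> simp [Fin.sum_univ_succ, εv, epsE7, ι6]
  have e0 := hn 0
  have e1 := hn 1
  have e2 := hn 2
  have e3 := hn 3
  have e4 := hn 4
  have e5 := hn 5
  have e6 := hn 6
  simp [simpleE7, epsE7, inner_add_right, inner_sub_right, inner_smul_right, inner_εv, hcoord,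
    h1, h2, h3, h4, h5, h6] at e0 e1 e2 e3 e4 e5 e6
  rcases hn0 with h0 | h0 <;> simp [h0] at e0
  · left
    ext i
    rw [hcoord]
    fin_cases i <;> simp <;> linarith
  · right
    ext i
    rw [hcoord]
    fin_cases i <;> simp [εv, epsE7] <;> linarith
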